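/- Fix v_min < v_max, an integer N ≥ 2, Δz = (v_max - v_min)/(N-1), and atoms z_i = v_min + i·Δz for i = 0, …, N-1. Let p_0, …, p_{M-1} be nonnegative reals with Σ_j p_j = 1, and let z'_0, …, z'_{M-1} ∈ [v_min, v_max]. Define m_i = Σ_{j=0}^{M-1} p_j · max(0, 1 - |z'_j - z_i|/Δz). Then m_i ≥ 0 for every i and Σ_{i=0}^{N-1} m_i = 1; i.e., the C51 projection of a categorical target distribution is again a probability distribution over the atoms. -/

import Mathlib

lemma hat_sum (x : ℝ) (hx : 0 ≤ x) (n : ℕ) :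
    ∑ i ∈ Finset.range (n + 1), max 0 (1 - |x - (i : ℝ)|) = max 0 (min 1 ((n : ℝ) + 1 - x)) := by
  induction n with
  | zero =>
    simp only [zero_add, Finset.sum_range_one, Nat.cast_zero, sub_zero, abs_of_nonneg hx]
    rw [min_eq_right (by linarith)]
  | succ k ih =>
    rw [Finset.sum_range_succ, ih]
    push_cast
    rcases abs_cases (x - ((k : ℝ) + 1)) with ⟨h, h'⟩ | ⟨h, h'⟩ <;> rw [h] <;>
    rcases max_cases (0 : ℝ) (min 1 ((k : ℝ) + 1 - x)) with ⟨h1, h1'⟩ | ⟨h1, h1'⟩ <;> rw [h1] <;>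
    rcases min_cases (1 : ℝ) ((k : ℝ) + 1 - x) with ⟨h2, h2'⟩ | ⟨h2, h2'⟩ <;>
    rcases min_cases (1 : ℝ) ((k : ℝ) + 1 + 1 - x) with ⟨h3, h3'⟩ | ⟨h3, h3'⟩ <;> rw [h3] <;>
    simp only [max_def] <;> split_ifs <;> linarith

/-- **The C51 projection of a categorical target is a probability distribution.**
With atoms `z_i = v_min + i·Δz`, `Δz = (v_max - v_min)/(N-1)`, target
probabilities `p_j ≥ 0` summing to `1`, and support points
`z'_j ∈ [v_min, v_max]`, the projected weights
`m_i = Σ_j p_j · max(0, 1 - |z'_j - z_i|/Δz)` satisfy `m_i ≥ 0` and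
`Σ_i m_i = 1`. -/
theorem stmt14 (vmin vmax : ℝ) (hlt : vmin < vmax) (N : ℕ) (hN : 2 ≤ N)
    (Δz : ℝ) (hΔz : Δz = (vmax - vmin) / ((N : ℝ) - 1))
    (atom : Fin N → ℝ) (hatom : ∀ i, atom i = vmin + (i : ℝ) * Δz)
    (M : ℕ) (p : Fin M → ℝ) (hp : ∀ j, 0 ≤ p j) (hp1 : ∑ j, p j = 1)
    (z' : Fin M → ℝ) (hz' : ∀ j, z' j ∈ Set.Icc vmin vmax)
    (m : Fin N → ℝ)
    (hm : ∀ i, m i = ∑ j, p j * max 0 (1 - |z' j - atom i| / Δz)) :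
    (∀ i, 0 ≤ m i) ∧ ∑ i, m i = 1 := by
  have hN1 : (0 : ℝ) < (N : ℝ) - 1 := by
    have : (2 : ℝ) ≤ N := by exact_mod_cast hN
    linarith
  have hd : 0 < Δz := by rw [hΔz]; exact div_pos (by linarith) hN1
  refine ⟨fun i => ?_, ?_⟩
  · rw [hm]
    exact Finset.sum_nonneg fun j _ => mul_nonneg (hp j) (le_max_left _ _)
  · have key : ∀ j, ∑ i : Fin N, max 0 (1 - |z' j - atom i| / Δz) = 1 := by
      intro j
      obtain ⟨ha, hb⟩ := hz' j
      have hx0 : 0 ≤ (z' j - vmin) / Δz := div_nonneg (by linarith) hd.le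
      have hmul : ((N : ℝ) - 1) * Δz = vmax - vmin := by
        rw [hΔz]; field_simp
      have hx1 : (z' j - vmin) / Δz ≤ (N : ℝ) - 1 := by
        rw [div_le_iff₀ hd]; linarith
      have he : ∀ i : Fin N, max 0 (1 - |z' j - atom i| / Δz)
          = max 0 (1 - |(z' j - vmin) / Δz - ((i : ℕ) : ℝ)|) := by
        intro i
        have : (z' j - vmin) / Δz - ((i : ℕ) : ℝ) = (z' j - atom i) / Δz := by
          rw [hatom]; field_simp; ring
        rw [this, abs_div, abs_of_pos hd]
      rw [Finset.sum_congr rfl fun i _ => he i,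
        Fin.sum_univ_eq_sum_range (fun i : ℕ => max 0 (1 - |(z' j - vmin) / Δz - (i : ℝ)|)) N]
      obtain ⟨n, rfl⟩ : ∃ n, N = n + 1 := ⟨N - 1, by omega⟩
      rw [hat_sum _ hx0]
      push_cast at hx1
      rw [min_eq_left (by linarith), max_eq_right zero_le_one]
    simp_rw [hm]
    rw [Finset.sum_comm]
    simp_rw [← Finset.mul_sum, key, mul_one]
    exact hp1
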